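/- arXiv:2102.05827 — 5 statements merged into one kernel-verified Lean document; each statement's English description precedes it below -/
import Mathlib

section
/- Let (V, C, e) be an operator system and let p ∈ V be a positive contraction. Define T_n := {hermitian x ∈ M_n(V) : x ⊗ J_2 ∈ C(p)_n}; then T = (T_n) is a matrix ordering on V containing C, and p is a positive contraction for T. Define T(p)_n := {hermitian x ∈ M_{2n}(V) : for every ε > 0 there exists t > 0 with x + ε·(I_n ⊗ (p ⊕ p^⊥)) + t·(I_n ⊗ (p^⊥ ⊕ p)) ∈ T_{2n}}. Then T(p)_n = C(p)_n for every n ≥ 1. -/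
open scoped ComplexOrder

/-- `x` is a hermitian matrix over a ∗-vector space. -/
def IsHermMat {V ι : Type} [Star V] (x : Matrix ι ι V) : Prop :=
  ∀ i j, x j i = star (x i j)

/-- A family of cones of matrices over `V`, one for each finite matrix-index type. -/
abbrev ConeFamily (V : Type) : Type 1 :=
  ∀ (ι : Type) [Fintype ι] [DecidableEq ι], Set (Matrix ι ι V)

section Core

variable {V : Type} [AddCommGroup V] [Module ℂ V] [StarAddMonoid V] [StarModule ℂ V]

/-- conjugation `α* x α` of `x ∈ M_ι(V)` by a scalar matrix `α : M_{ι,κ}(ℂ)`. -/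
def conjBy {ι κ : Type} [Fintype ι] (α : Matrix ι κ ℂ) (x : Matrix ι ι V) :
    Matrix κ κ V :=
  Matrix.of fun s t => ∑ i, ∑ j, ((starRingEnd ℂ) (α i s) * α j t) • x i j

/-- `C` is a matrix ordering on the ∗-vector space `V`. -/
structure IsMatrixOrdering (C : ConeFamily V) : Prop where
  herm_mem : ∀ (ι : Type) [Fintype ι] [DecidableEq ι], ∀ x ∈ C ι, IsHermMat x
  add_mem : ∀ (ι : Type) [Fintype ι] [DecidableEq ι], ∀ x ∈ C ι, ∀ y ∈ C ι, x + y ∈ C ι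
  smul_mem : ∀ (ι : Type) [Fintype ι] [DecidableEq ι], ∀ r : ℝ, 0 ≤ r → ∀ x ∈ C ι,
    (r : ℂ) • x ∈ C ι
  conj_mem : ∀ (ι κ : Type) [Fintype ι] [DecidableEq ι] [Fintype κ] [DecidableEq κ],
    ∀ (α : Matrix ι κ ℂ), ∀ x ∈ C ι, conjBy α x ∈ C κ

/-- the diagonal matrix `I_ι ⊗ e` with `e` in every diagonal entry. -/
def unitMat {ι : Type} [DecidableEq ι] (e : V) : Matrix ι ι V :=
  Matrix.of fun i j => if i = j then e else 0

/-- membership of an element of `V` in the ground-level cone `C_1`. -/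
def Mem1 (C : ConeFamily V) (v : V) : Prop :=
  (Matrix.of fun _ _ => v : Matrix (Fin 1) (Fin 1) V) ∈ C (Fin 1)

/-- `(V, C, e)` is an (abstract) operator system: `C` is a proper matrix ordering and
`e` is an Archimedean matrix order unit. -/
structure IsOperatorSystem (C : ConeFamily V) (e : V) extends IsMatrixOrdering C : Prop where
  proper : ∀ (ι : Type) [Fintype ι] [DecidableEq ι], ∀ x ∈ C ι, -x ∈ C ι → x = 0
  unit_mem : Mem1 C e
  orderUnit : ∀ (ι : Type) [Fintype ι] [DecidableEq ι], ∀ x : Matrix ι ι V, IsHermMat x →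
    ∃ t : ℝ, 0 < t ∧ (t : ℂ) • (unitMat e : Matrix ι ι V) - x ∈ C ι
  arch : ∀ (ι : Type) [Fintype ι] [DecidableEq ι], ∀ x : Matrix ι ι V,
    (∀ ε : ℝ, 0 < ε → x + (ε : ℂ) • (unitMat e : Matrix ι ι V) ∈ C ι) → x ∈ C ι

/-- `p` is a positive contraction: `p ∈ C_1` and `e - p ∈ C_1`. -/
def IsPosCon (C : ConeFamily V) (e p : V) : Prop :=
  Mem1 C p ∧ Mem1 C (e - p)

/-- the `2 × 2` diagonal matrix `p ⊕ q` over `V`. -/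
def diagPQ (p q : V) : Matrix (Fin 2) (Fin 2) V :=
  Matrix.of fun s t => if s = t then (if s = 0 then p else q) else 0

/-- `I_ι ⊗ y`. -/
def idKron {ι κ : Type} [DecidableEq ι] (y : Matrix κ κ V) : Matrix (ι × κ) (ι × κ) V :=
  Matrix.of fun a b => if a.1 = b.1 then y a.2 b.2 else 0

/-- `x ⊗ J_κ`, the Kronecker product of `x` with the all-ones matrix. -/
def onesKron {ι κ : Type} (x : Matrix ι ι V) : Matrix (ι × κ) (ι × κ) V :=
  Matrix.of fun a b => x a.1 b.1

/-- the cone `C(p)_ι ⊆ M_{ι × 2}(V)` associated to a positive contraction `p`. -/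
def coneP (C : ConeFamily V) (e p : V) (ι : Type) [Fintype ι] [DecidableEq ι] :
    Set (Matrix (ι × Fin 2) (ι × Fin 2) V) :=
  {x | IsHermMat x ∧ ∀ ε : ℝ, 0 < ε → ∃ t : ℝ, 0 < t ∧
    x + (ε : ℂ) • idKron (diagPQ p (e - p)) + (t : ℂ) • idKron (diagPQ (e - p) p)
      ∈ C (ι × Fin 2)}

end Core

section Stmt1

variable {V : Type} [AddCommGroup V] [Module ℂ V] [StarAddMonoid V] [StarModule ℂ V]

/-- the family `T` with `T_ι = {hermitian x : x ⊗ J₂ ∈ C(p)_ι}`. -/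
def Tfam (C : ConeFamily V) (e p : V) : ConeFamily V :=
  fun ι _ _ => {x | IsHermMat x ∧ onesKron (κ := Fin 2) x ∈ coneP C e p ι}

end Stmt1

section ScalarConjugation

variable {V : Type} [AddCommGroup V] [Module ℂ V]

/-- The Kronecker product `M ⊗ y` of a scalar matrix with a matrix over `V`. -/
def scalarKron {ι κ : Type} (M : Matrix ι ι ℂ) (y : Matrix κ κ V) :
    Matrix (ι × κ) (ι × κ) V :=
  Matrix.of fun a b => M a.1 b.1 • y a.2 b.2

/-- The scalar matrix `α ⊗ I_τ`. -/
def ampl {ι κ : Type} (τ : Type) [DecidableEq τ] (α : Matrix ι κ ℂ) :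
    Matrix (ι × τ) (κ × τ) ℂ :=
  Matrix.of fun a b => if a.2 = b.2 then α a.1 b.1 else 0

theorem scalarKron_one {ι κ : Type} [DecidableEq ι] (y : Matrix κ κ V) :
    scalarKron (1 : Matrix ι ι ℂ) y = idKron y := by
  ext a b
  simp [scalarKron, idKron, Matrix.one_apply, ite_smul]

theorem conjBy_add {ι κ : Type} [Fintype ι] (α : Matrix ι κ ℂ) (x y : Matrix ι ι V) :
    conjBy α (x + y) = conjBy α x + conjBy α y := by
  ext s t
  simp [conjBy, Finset.sum_add_distrib]

theorem conjBy_smul {ι κ : Type} [Fintype ι] (α : Matrix ι κ ℂ) (c : ℂ) (x : Matrix ι ι V) :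
    conjBy α (c • x) = c • conjBy α x := by
  ext s t
  simp [conjBy, Finset.smul_sum, smul_comm c]

theorem conjBy_ampl_scalarKron {ι κ τ : Type} [Fintype ι] [Fintype τ] [DecidableEq τ]
    (α : Matrix ι κ ℂ) (M : Matrix ι ι ℂ) (y : Matrix τ τ V) :
    conjBy (ampl τ α) (scalarKron M y) = scalarKron (α.conjTranspose * M * α) y := by
  ext s t
  have h : conjBy (ampl τ α) (scalarKron M y) s t =
      ∑ i, ∑ j, ((starRingEnd ℂ) (α i s.1) * α j t.1) • M i j • y s.2 t.2 := by
    simp only [conjBy, ampl, scalarKron, Matrix.of_apply, Fintype.sum_prod_type]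
    refine Finset.sum_congr rfl fun i _ => ?_
    rw [Finset.sum_comm]
    refine Finset.sum_congr rfl fun j _ => ?_
    simp [apply_ite, ite_smul]
  rw [h, Finset.sum_comm]
  simp only [scalarKron, Matrix.of_apply, Matrix.mul_apply, Matrix.conjTranspose_apply,
    Finset.sum_mul, Finset.sum_smul, smul_smul]
  refine Finset.sum_congr rfl fun i _ => Finset.sum_congr rfl fun j _ => ?_
  rw [starRingEnd_apply, mul_right_comm]

theorem conjBy_ampl_onesKron {ι κ τ : Type} [Fintype ι] [Fintype τ] [DecidableEq τ]
    (α : Matrix ι κ ℂ) (x : Matrix ι ι V) :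
    conjBy (ampl τ α) (onesKron (κ := τ) x) = onesKron (κ := τ) (conjBy α x) := by
  ext s t
  simp only [conjBy, ampl, onesKron, Matrix.of_apply, Fintype.sum_prod_type]
  refine Finset.sum_congr rfl fun i _ => ?_
  rw [Finset.sum_comm]
  refine Finset.sum_congr rfl fun j _ => ?_
  simp [apply_ite, ite_smul]

end ScalarConjugation

section HermitianMatrices

theorem IsHermMat.add {V ι : Type} [AddCommGroup V] [StarAddMonoid V] {x y : Matrix ι ι V}
    (hx : IsHermMat x) (hy : IsHermMat y) :
    IsHermMat (x + y) := fun i j => by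
  simp [hx i j, hy i j]

theorem IsHermMat.real_smul {V ι : Type} [AddCommGroup V] [Module ℂ V] [StarAddMonoid V]
    [StarModule ℂ V] {x : Matrix ι ι V} (hx : IsHermMat x) (r : ℝ) :
    IsHermMat ((r : ℂ) • x) := fun i j => by
  simp [hx i j, star_smul]

theorem IsHermMat.conjBy {V ι κ : Type} [AddCommGroup V] [Module ℂ V] [StarAddMonoid V]
    [StarModule ℂ V] [Fintype ι] {x : Matrix ι ι V} (hx : IsHermMat x)
    (α : Matrix ι κ ℂ) : IsHermMat (conjBy α x) := fun s t => by
  simp only [_root_.conjBy, Matrix.of_apply, star_sum, star_smul]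
  rw [Finset.sum_comm]
  refine Finset.sum_congr rfl fun i _ => Finset.sum_congr rfl fun j _ => ?_
  rw [hx i j]
  simp [mul_comm]

theorem IsHermMat.onesKron {V ι κ : Type} [Star V] {x : Matrix ι ι V} (hx : IsHermMat x) :
    IsHermMat (onesKron (κ := κ) x) := fun a b => hx a.1 b.1

end HermitianMatrices

/-- Every complex matrix `α` satisfies `α*α ≤ c` for some positive real `c`. -/
theorem exists_posSemidef_smul_one_sub {ι κ : Type} [Fintype ι] [Fintype κ] [DecidableEq κ]
    (α : Matrix ι κ ℂ) :
    ∃ c : ℝ, 0 < c ∧ ((c : ℂ) • (1 : Matrix κ κ ℂ) - α.conjTranspose * α).PosSemidef := by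
  open scoped Matrix.Norms.L2Operator MatrixOrder in
  have hsa : IsSelfAdjoint (α.conjTranspose * α) :=
    (Matrix.isHermitian_conjTranspose_mul_self α).isSelfAdjoint
  have h := Matrix.le_iff.mp hsa.le_algebraMap_norm_self
  refine ⟨‖α.conjTranspose * α‖ + 1, by positivity, ?_⟩
  have h2 := h.add Matrix.PosSemidef.one
  rw [Algebra.algebraMap_eq_smul_one] at h2
  have key : ((‖α.conjTranspose * α‖ + 1 : ℝ) : ℂ) • (1 : Matrix κ κ ℂ) - α.conjTranspose * α =
      ‖α.conjTranspose * α‖ • (1 : Matrix κ κ ℂ) - α.conjTranspose * α + 1 := by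
    rw [Complex.ofReal_add, Complex.ofReal_one, add_smul, one_smul, Complex.coe_smul]
    abel
  rw [key]
  exact h2

namespace IsMatrixOrdering

variable {V : Type} [AddCommGroup V] [Module ℂ V] [StarAddMonoid V] {C : ConeFamily V}

theorem zero_mem_of_mem (hC : IsMatrixOrdering C) {ι : Type} [Fintype ι] [DecidableEq ι]
    {x : Matrix ι ι V} (hx : x ∈ C ι) (κ : Type) [Fintype κ] [DecidableEq κ] :
    (0 : Matrix κ κ V) ∈ C κ := by
  have h := hC.conj_mem ι κ 0 x hx
  convert h
  ext s t
  simp [conjBy]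

theorem scalarKron_mem (hC : IsMatrixOrdering C) {ι κ : Type} [Fintype ι] [DecidableEq ι]
    [Fintype κ] [DecidableEq κ] {M : Matrix ι ι ℂ} (hM : M.PosSemidef) {y : Matrix κ κ V}
    (hy : y ∈ C κ) : scalarKron M y ∈ C (ι × κ) := by
  obtain ⟨B, rfl⟩ : ∃ B : Matrix ι ι ℂ, M = B.conjTranspose * B := by
    open scoped MatrixOrder in
    exact CStarAlgebra.nonneg_iff_eq_star_mul_self.mp hM.nonneg
  have key : scalarKron (B.conjTranspose * B) y = ∑ i, conjBy
      (Matrix.of fun k (b : ι × κ) => if k = b.2 then B i b.1 else 0) y := by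
    ext s t
    simp [scalarKron, conjBy, Matrix.mul_apply, Matrix.sum_apply, Finset.sum_smul, apply_ite,
      ite_smul]
  rw [key]
  have aux : ∀ S : Finset ι, ∑ i ∈ S, conjBy
      (Matrix.of fun k (b : ι × κ) => if k = b.2 then B i b.1 else 0) y ∈ C (ι × κ) := by
    intro S
    induction S using Finset.induction_on with
    | empty => simpa using hC.zero_mem_of_mem hy (ι × κ)
    | insert i S hi ih =>
      rw [Finset.sum_insert hi]
      exact hC.add_mem _ _ (hC.conj_mem _ _ _ _ hy) _ ih
  exact aux Finset.univ

theorem idKron_mem (hC : IsMatrixOrdering C) {ι κ : Type} [Fintype ι] [DecidableEq ι]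
    [Fintype κ] [DecidableEq κ] {y : Matrix κ κ V} (hy : y ∈ C κ) :
    idKron (ι := ι) y ∈ C (ι × κ) := by
  rw [← scalarKron_one]
  exact hC.scalarKron_mem Matrix.PosSemidef.one hy

theorem diagPQ_mem (hC : IsMatrixOrdering C) {p q : V} (hp : Mem1 C p) (hq : Mem1 C q) :
    diagPQ p q ∈ C (Fin 2) := by
  have h := hC.add_mem _ _
    (hC.conj_mem _ (Fin 2) (Matrix.of fun _ s => if s = 0 then 1 else 0) _ hp) _
    (hC.conj_mem _ (Fin 2) (Matrix.of fun _ s => if s = 1 then 1 else 0) _ hq)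
  convert h
  ext s t
  fin_cases s <;> fin_cases t <;> simp [diagPQ, conjBy]

theorem onesKron_mem (hC : IsMatrixOrdering C) {ι κ : Type} [Fintype ι] [DecidableEq ι]
    [Fintype κ] [DecidableEq κ] {x : Matrix ι ι V} (hx : x ∈ C ι) :
    onesKron (κ := κ) x ∈ C (ι × κ) := by
  have h := hC.conj_mem _ (ι × κ) (Matrix.of fun i (a : ι × κ) => if i = a.1 then 1 else 0) _ hx
  convert h
  ext s t
  simp [onesKron, conjBy, apply_ite, ite_smul]

theorem subset_coneP (hC : IsMatrixOrdering C) {e p : V} (hp : IsPosCon C e p) {ι : Type}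
    [Fintype ι] [DecidableEq ι] {x : Matrix (ι × Fin 2) (ι × Fin 2) V}
    (hx : x ∈ C (ι × Fin 2)) : x ∈ coneP C e p ι :=
  ⟨hC.herm_mem _ x hx, fun _ hε => ⟨1, one_pos,
    hC.add_mem _ _ (hC.add_mem _ _ hx _
      (hC.smul_mem _ _ hε.le _ (hC.idKron_mem (hC.diagPQ_mem hp.1 hp.2)))) _
      (hC.smul_mem _ _ zero_le_one _ (hC.idKron_mem (hC.diagPQ_mem hp.2 hp.1)))⟩⟩

theorem coneP_add_mem (hC : IsMatrixOrdering C) {e p : V} {ι : Type}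
    [Fintype ι] [DecidableEq ι] {x y : Matrix (ι × Fin 2) (ι × Fin 2) V}
    (hx : x ∈ coneP C e p ι) (hy : y ∈ coneP C e p ι) : x + y ∈ coneP C e p ι := by
  refine ⟨hx.1.add hy.1, fun ε hε => ?_⟩
  obtain ⟨s, hs, hxs⟩ := hx.2 (ε / 2) (half_pos hε)
  obtain ⟨t, ht, hyt⟩ := hy.2 (ε / 2) (half_pos hε)
  refine ⟨s + t, add_pos hs ht, ?_⟩
  convert hC.add_mem _ _ hxs _ hyt using 1
  push_cast
  module

theorem coneP_smul_mem [StarModule ℂ V] (hC : IsMatrixOrdering C) {e p : V} (hp : IsPosCon C e p)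
    {ι : Type} [Fintype ι] [DecidableEq ι] {r : ℝ} (hr : 0 ≤ r)
    {x : Matrix (ι × Fin 2) (ι × Fin 2) V}
    (hx : x ∈ coneP C e p ι) : (r : ℂ) • x ∈ coneP C e p ι := by
  rcases hr.eq_or_lt with rfl | hr
  · simpa using hC.subset_coneP hp (hC.zero_mem_of_mem hp.1 (ι × Fin 2))
  refine ⟨hx.1.real_smul r, fun ε hε => ?_⟩
  obtain ⟨t, ht, h⟩ := hx.2 (ε / r) (div_pos hε hr)
  refine ⟨r * t, mul_pos hr ht, ?_⟩
  convert hC.smul_mem _ r hr.le _ h using 1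
  have hr' : (r : ℂ) ≠ 0 := by exact_mod_cast hr.ne'
  push_cast
  rw [smul_add, smul_add, smul_smul, smul_smul, mul_div_cancel₀ _ hr']

theorem coneP_conj_mem [StarModule ℂ V] (hC : IsMatrixOrdering C) {e p : V} (hp : IsPosCon C e p)
    {ι κ : Type}
    [Fintype ι] [DecidableEq ι] [Fintype κ] [DecidableEq κ] (α : Matrix ι κ ℂ)
    {x : Matrix (ι × Fin 2) (ι × Fin 2) V} (hx : x ∈ coneP C e p ι) :
    conjBy (ampl (Fin 2) α) x ∈ coneP C e p κ := by
  refine ⟨hx.1.conjBy _, fun ε hε => ?_⟩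
  obtain ⟨c, hc, hα⟩ := exists_posSemidef_smul_one_sub α
  obtain ⟨t, ht, h⟩ := hx.2 (ε / c) (div_pos hε hc)
  refine ⟨t * c, mul_pos ht hc, ?_⟩
  have h1 := hC.conj_mem _ _ (ampl (Fin 2) α) _ h
  have hP := hC.smul_mem _ (ε / c) (div_pos hε hc).le _
    (hC.scalarKron_mem hα (hC.diagPQ_mem hp.1 hp.2))
  have hQ := hC.smul_mem _ t ht.le _ (hC.scalarKron_mem hα (hC.diagPQ_mem hp.2 hp.1))
  have hsub : ∀ y : Matrix (Fin 2) (Fin 2) V,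
      scalarKron ((c : ℂ) • (1 : Matrix κ κ ℂ) - α.conjTranspose * α) y =
        (c : ℂ) • idKron y - scalarKron (α.conjTranspose * α) y := by
    intro y
    rw [← scalarKron_one]
    ext a b
    simp [scalarKron, sub_smul, mul_smul]
  rw [conjBy_add, conjBy_add, conjBy_smul, conjBy_smul, ← scalarKron_one, ← scalarKron_one,
    conjBy_ampl_scalarKron, conjBy_ampl_scalarKron, Matrix.mul_one] at h1
  rw [hsub] at hP hQ
  convert hC.add_mem _ _ (hC.add_mem _ _ h1 _ hP) _ hQ using 1
  have hεc : (ε : ℂ) = ((ε / c : ℝ) : ℂ) * (c : ℂ) := by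
    rw [← Complex.ofReal_mul, div_mul_cancel₀ _ hc.ne']
  rw [hεc, Complex.ofReal_mul]
  module

theorem subset_Tfam (hC : IsMatrixOrdering C) {e p : V} (hp : IsPosCon C e p) (ι : Type)
    [Fintype ι] [DecidableEq ι] : C ι ⊆ Tfam C e p ι := fun x hx =>
  ⟨hC.herm_mem _ x hx, hC.subset_coneP hp (hC.onesKron_mem hx)⟩

theorem isMatrixOrdering_Tfam [StarModule ℂ V] (hC : IsMatrixOrdering C) {e p : V}
    (hp : IsPosCon C e p) :
    IsMatrixOrdering (Tfam C e p) where
  herm_mem _ _ _ _ hx := hx.1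
  add_mem _ _ _ _ hx _ hy := ⟨hx.1.add hy.1, hC.coneP_add_mem hx.2 hy.2⟩
  smul_mem _ _ _ r hr _ hx := ⟨hx.1.real_smul r, hC.coneP_smul_mem hp hr hx.2⟩
  conj_mem _ _ _ _ _ _ α x hx := ⟨hx.1.conjBy α, by
    rw [← conjBy_ampl_onesKron]
    exact hC.coneP_conj_mem hp α hx.2⟩

/-- Compressing `x ⊗ J₂ + δ I ⊗ (p ⊕ p^⊥) + s I ⊗ (p^⊥ ⊕ p)` to the coordinates `(i, a, a)`. -/
theorem add_mem_of_onesKron_add_mem (hC : IsMatrixOrdering C) {p q : V} {ι : Type}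
    [Fintype ι] [DecidableEq ι] {x : Matrix (ι × Fin 2) (ι × Fin 2) V} {δ s : ℂ}
    (h : onesKron (κ := Fin 2) x + δ • idKron (diagPQ p q) + s • idKron (diagPQ q p)
      ∈ C ((ι × Fin 2) × Fin 2)) :
    x + δ • idKron (diagPQ p q) + s • idKron (diagPQ q p) ∈ C (ι × Fin 2) := by
  have h1 := hC.conj_mem _ (ι × Fin 2)
    (Matrix.of fun a (b : ι × Fin 2) => if a = (b, b.2) then 1 else 0) _ h
  convert h1
  ext ⟨i, a⟩ ⟨j, b⟩
  simp only [conjBy, Matrix.of_apply, apply_ite, map_one, map_zero, mul_one, mul_zero,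
    ite_smul, one_smul, zero_smul, Finset.sum_ite_eq', Finset.mem_univ, if_true]
  by_cases hij : i = j <;> fin_cases a <;> fin_cases b <;>
    simp [onesKron, idKron, diagPQ, hij]

theorem coneP_Tfam (hC : IsMatrixOrdering C) {e p : V} (hp : IsPosCon C e p) (ι : Type)
    [Fintype ι] [DecidableEq ι] : coneP (Tfam C e p) e p ι = coneP C e p ι := by
  refine Set.Subset.antisymm (fun x hx => ⟨hx.1, fun ε hε => ?_⟩) fun x hx =>
    ⟨hx.1, fun ε hε => ?_⟩
  · obtain ⟨t, ht, h⟩ := hx.2 (ε / 2) (half_pos hε)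
    obtain ⟨s, hs, h'⟩ := h.2.2 (ε / 2) (half_pos hε)
    refine ⟨t + s, add_pos ht hs, ?_⟩
    convert hC.add_mem_of_onesKron_add_mem h' using 1
    push_cast
    module
  · obtain ⟨t, ht, h⟩ := hx.2 ε hε
    exact ⟨t, ht, hC.subset_Tfam hp _ h⟩

end IsMatrixOrdering

section Stmt1

variable {V : Type} [AddCommGroup V] [Module ℂ V] [StarAddMonoid V] [StarModule ℂ V]

theorem stmt_1 (C : ConeFamily V) (e : V) (hos : IsOperatorSystem C e)
    (p : V) (hp : IsPosCon C e p) :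
    IsMatrixOrdering (Tfam C e p) ∧
    (∀ (ι : Type) [Fintype ι] [DecidableEq ι], C ι ⊆ Tfam C e p ι) ∧
    IsPosCon (Tfam C e p) e p ∧
    (∀ (ι : Type) [Fintype ι] [DecidableEq ι],
      coneP (Tfam C e p) e p ι = coneP C e p ι) := by
  have hC := hos.toIsMatrixOrdering
  exact ⟨hC.isMatrixOrdering_Tfam hp, hC.subset_Tfam hp,
    ⟨hC.subset_Tfam hp _ hp.1, hC.subset_Tfam hp _ hp.2⟩, hC.coneP_Tfam hp⟩

end Stmt1
end

section
/- Let (V, C, e) be an operator system and let p_1, …, p_N ∈ V be positive contractions. Then for all N, n ≥ 1, Ĉ(p_1, …, p_N)_n ⊆ C(p_1, …, p_N)_n. -/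
open scoped ComplexOrder

section Multi

variable {V : Type} [AddCommGroup V] [Module ℂ V] [StarAddMonoid V] [StarModule ℂ V] {N : ℕ}

/-- `P_k^N = I_{2^{k-1}} ⊗ (p_k ⊕ p_k^⊥) ⊗ J_{2^{N-k}}` as a matrix indexed by binary
strings of length `N` (the `j`-th bit corresponding to the `j`-th tensor factor of `2^N`). -/
def Pm (e : V) (p : Fin N → V) (k : Fin N) :
    Matrix (Fin N → Fin 2) (Fin N → Fin 2) V :=
  Matrix.of fun σ τ =>
    if (∀ j, j < k → σ j = τ j) ∧ σ k = τ k then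
      (if σ k = 0 then p k else e - p k) else 0

/-- `Q_k^N = I_{2^{k-1}} ⊗ (p_k^⊥ ⊕ p_k) ⊗ J_{2^{N-k}}`. -/
def Qm (e : V) (p : Fin N → V) (k : Fin N) :
    Matrix (Fin N → Fin 2) (Fin N → Fin 2) V :=
  Matrix.of fun σ τ =>
    if (∀ j, j < k → σ j = τ j) ∧ σ k = τ k then
      (if σ k = 0 then e - p k else p k) else 0

/-- `P̂_k^N = J_{2^{k-1}} ⊗ (p_k ⊕ p_k^⊥) ⊗ J_{2^{N-k}}`. -/
def PmHat (e : V) (p : Fin N → V) (k : Fin N) :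
    Matrix (Fin N → Fin 2) (Fin N → Fin 2) V :=
  Matrix.of fun σ τ =>
    if σ k = τ k then (if σ k = 0 then p k else e - p k) else 0

/-- `Q̂_k^N = J_{2^{k-1}} ⊗ (p_k^⊥ ⊕ p_k) ⊗ J_{2^{N-k}}`. -/
def QmHat (e : V) (p : Fin N → V) (k : Fin N) :
    Matrix (Fin N → Fin 2) (Fin N → Fin 2) V :=
  Matrix.of fun σ τ =>
    if σ k = τ k then (if σ k = 0 then e - p k else p k) else 0

/-- `x + Σ_k ε_k (I_ι ⊗ P_k^N) + Σ_k t_k (I_ι ⊗ Q_k^N) ∈ C_{ι·2^N}`. -/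
def MemMulti (C : ConeFamily V) (e : V) (p : Fin N → V)
    (ι : Type) [Fintype ι] [DecidableEq ι]
    (x : Matrix (ι × (Fin N → Fin 2)) (ι × (Fin N → Fin 2)) V) (ε t : Fin N → ℝ) : Prop :=
  x + ∑ k, (ε k : ℂ) • idKron (Pm e p k) + ∑ k, (t k : ℂ) • idKron (Qm e p k)
    ∈ C (ι × (Fin N → Fin 2))

/-- the cone `C(p_1, …, p_N)_ι ⊆ M_{ι·2^N}(V)`. -/
def coneMulti (C : ConeFamily V) (e : V) (p : Fin N → V)
    (ι : Type) [Fintype ι] [DecidableEq ι] :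
    Set (Matrix (ι × (Fin N → Fin 2)) (ι × (Fin N → Fin 2)) V) :=
  {x | IsHermMat x ∧ ∀ ε : Fin N → ℝ, (∀ i, 0 < ε i) →
    ∃ t : Fin N → ℝ, (∀ i, 0 < t i) ∧ MemMulti C e p ι x ε t ∧
      ∀ (i : Fin N) (ε' : ℝ), 0 < ε' → ε' < ε i →
        ∃ t' : ℝ, t i < t' ∧
          MemMulti C e p ι x (Function.update ε i ε') (Function.update t i t')}

/-- the `⊗J`-version of `MemMulti`, with `P̂`, `Q̂` in place of `P`, `Q`. -/
def MemMultiHat (C : ConeFamily V) (e : V) (p : Fin N → V)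
    (ι : Type) [Fintype ι] [DecidableEq ι]
    (x : Matrix (ι × (Fin N → Fin 2)) (ι × (Fin N → Fin 2)) V) (ε t : Fin N → ℝ) : Prop :=
  x + ∑ k, (ε k : ℂ) • idKron (PmHat e p k) + ∑ k, (t k : ℂ) • idKron (QmHat e p k)
    ∈ C (ι × (Fin N → Fin 2))

/-- the cone `Ĉ(p_1, …, p_N)_ι ⊆ M_{ι·2^N}(V)`. -/
def coneMultiHat (C : ConeFamily V) (e : V) (p : Fin N → V)
    (ι : Type) [Fintype ι] [DecidableEq ι] :
    Set (Matrix (ι × (Fin N → Fin 2)) (ι × (Fin N → Fin 2)) V) :=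
  {x | IsHermMat x ∧ ∀ ε : Fin N → ℝ, (∀ i, 0 < ε i) →
    ∃ t : Fin N → ℝ, (∀ i, 0 < t i) ∧ MemMultiHat C e p ι x ε t ∧
      ∀ (i : Fin N) (ε' : ℝ), 0 < ε' → ε' < ε i →
        ∃ t' : ℝ, t i < t' ∧
          MemMultiHat C e p ι x (Function.update ε i ε') (Function.update t i t')}

end Multi

section Comparison

variable {V : Type} [AddCommGroup V] [Module ℂ V] [StarAddMonoid V]

lemma IsMatrixOrdering.sum_mem {C : ConeFamily V} (hC : IsMatrixOrdering C) {v : V}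
    (hv : Mem1 C v) {κ R : Type} [Fintype κ] [DecidableEq κ] (s : Finset R)
    (y : R → Matrix κ κ V) (hy : ∀ r ∈ s, y r ∈ C κ) : ∑ r ∈ s, y r ∈ C κ := by
  classical
  induction s using Finset.induction_on with
  | empty =>
    have h := hC.conj_mem (Fin 1) κ 0 _ hv
    have h0 : conjBy (0 : Matrix (Fin 1) κ ℂ) (Matrix.of fun _ _ => v) = 0 := by
      ext i j; simp [conjBy]
    rw [h0] at h
    simpa using h
  | insert r s hr ih =>
    rw [Finset.sum_insert hr]
    exact hC.add_mem κ _ (hy r (by simp)) _ (ih fun q hq => hy q (by simp [hq]))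

/-- A scalar Gram matrix tensored with a positive element is positive. -/
lemma IsMatrixOrdering.gram_mem {C : ConeFamily V} (hC : IsMatrixOrdering C) {v : V}
    (hv : Mem1 C v) {κ R : Type} [Fintype κ] [DecidableEq κ] [Fintype R] (f : R → κ → ℂ) :
    (Matrix.of fun x y => (∑ r, (starRingEnd ℂ) (f r x) * f r y) • v) ∈ C κ := by
  have h := hC.sum_mem hv Finset.univ (fun r => conjBy (Matrix.of fun _ : Fin 1 => f r)
    (Matrix.of fun _ _ => v)) fun r _ => hC.conj_mem _ _ _ _ hv
  convert h using 1
  ext x y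
  simp [conjBy, Matrix.sum_apply, Finset.sum_smul]

lemma sum_indicator_sub_mul {L : Type} [Fintype L] [DecidableEq L] (a b : L) :
    ∑ u : L, ∑ w : L, (((if a = u then 1 else 0) - (if a = w then 1 else 0)) *
      ((if b = u then 1 else 0) - (if b = w then 1 else 0)) : ℂ)
      = 2 * (Fintype.card L * (if a = b then 1 else 0) - 1) := by
  simp only [sub_mul, mul_sub]
  simp only [Finset.sum_sub_distrib, Finset.sum_ite_irrel, Finset.sum_ite_eq, Finset.mem_univ,
    if_true, Finset.sum_const, Finset.card_univ, nsmul_eq_mul, mul_ite, mul_one, mul_zero]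
  split_ifs <;> ring

/-- The restriction of a binary string to the positions before `k`. -/
def bitsBefore {N : ℕ} (k : Fin N) (σ : Fin N → Fin 2) : {j // j < k} → Fin 2 := fun j => σ j

lemma bitsBefore_eq_iff {N : ℕ} {k : Fin N} {σ τ : Fin N → Fin 2} :
    bitsBefore k σ = bitsBefore k τ ↔ ∀ j, j < k → σ j = τ j := by
  simp [bitsBefore, funext_iff]

/-- The number of binary strings on the positions before `k`. -/
def countBefore {N : ℕ} (k : Fin N) : ℝ := Fintype.card ({j // j < k} → Fin 2)

lemma countBefore_pos {N : ℕ} (k : Fin N) : 0 < countBefore k := by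
  unfold countBefore
  exact_mod_cast Fintype.card_pos

/-- The part of `J ≤ m I` supported on strings whose `k`-th bit is `s`. -/
lemma IsMatrixOrdering.bit_block_mem {C : ConeFamily V} (hC : IsMatrixOrdering C) {v : V}
    (hv : Mem1 C v) {N : ℕ} (k : Fin N) (s : Fin 2) (ι : Type) [Fintype ι] [DecidableEq ι] :
    (Matrix.of fun x y : ι × (Fin N → Fin 2) =>
      if x.1 = y.1 ∧ x.2 k = s ∧ y.2 k = s then
        ((countBefore k : ℂ) * (if bitsBefore k x.2 = bitsBefore k y.2 then 1 else 0) - 1) • v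
      else 0) ∈ C (ι × (Fin N → Fin 2)) := by
  have h := hC.smul_mem _ (1 / 2) (by norm_num) _ (hC.gram_mem hv
    (fun (r : ι × ({j // j < k} → Fin 2) × ({j // j < k} → Fin 2))
      (x : ι × (Fin N → Fin 2)) => if x.2 k = s then (if x.1 = r.1 then
        (((if bitsBefore k x.2 = r.2.1 then 1 else 0) -
          (if bitsBefore k x.2 = r.2.2 then 1 else 0) : ℂ)) else 0) else 0))
  convert h using 1
  ext x y
  have key := sum_indicator_sub_mul (bitsBefore k x.2) (bitsBefore k y.2)
  by_cases hx : x.2 k = s <;> by_cases hy : y.2 k = s <;>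
    simp only [Matrix.of_apply, Matrix.smul_apply, hx, hy, and_true, and_false, if_true, if_false,
      zero_mul, mul_zero, map_zero, Finset.sum_const_zero, zero_smul, smul_zero]
  rw [Fintype.sum_prod_type, smul_smul]
  by_cases hxy : x.1 = y.1
  · rw [Finset.sum_eq_single y.1 (fun c _ hc => by simp [hxy, hc.symm]) (by simp)]
    simp only [hxy, if_true, Fintype.sum_prod_type, map_sub, apply_ite (starRingEnd ℂ), map_one,
      map_zero]
    rw [key]
    congr 1
    simp [countBefore]
  · rw [if_neg hxy, Finset.sum_eq_zero, mul_zero, zero_smul]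
    intro c _
    by_cases hc : x.1 = c
    · simp [show y.1 ≠ c from fun h => hxy (hc.trans h.symm)]
    · simp [hc]

lemma IsMatrixOrdering.count_smul_sub_mem {C : ConeFamily V} (hC : IsMatrixOrdering C) {a b : V}
    (ha : Mem1 C a) (hb : Mem1 C b) {N : ℕ} (k : Fin N) (ι : Type) [Fintype ι] [DecidableEq ι] :
    (countBefore k : ℂ) • idKron (Matrix.of fun σ τ : Fin N → Fin 2 =>
        if (∀ j, j < k → σ j = τ j) ∧ σ k = τ k then (if σ k = 0 then a else b) else 0)
      - idKron (Matrix.of fun σ τ : Fin N → Fin 2 =>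
        if σ k = τ k then (if σ k = 0 then a else b) else 0) ∈ C (ι × (Fin N → Fin 2)) := by
  convert hC.add_mem _ _ (hC.bit_block_mem ha k 0 ι) _ (hC.bit_block_mem hb k 1 ι) using 1
  ext x y
  simp only [idKron, Matrix.sub_apply, Matrix.smul_apply, Matrix.add_apply, Matrix.of_apply,
    ← bitsBefore_eq_iff]
  by_cases h1 : x.1 = y.1 <;> by_cases h2 : bitsBefore k x.2 = bitsBefore k y.2 <;>
    rcases Fin.exists_fin_two.mp ⟨x.2 k, rfl⟩ with h3 | h3 <;>
    rcases Fin.exists_fin_two.mp ⟨y.2 k, rfl⟩ with h4 | h4 <;>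
    simp [h1, h2, h3, h4, sub_smul]

lemma MemMultiHat.memMulti {C : ConeFamily V} {e : V} (hos : IsOperatorSystem C e)
    {N : ℕ} {p : Fin N → V} (hp : ∀ i, IsPosCon C e (p i))
    {ι : Type} [Fintype ι] [DecidableEq ι]
    {x : Matrix (ι × (Fin N → Fin 2)) (ι × (Fin N → Fin 2)) V} {ε t : Fin N → ℝ}
    (hε : ∀ i, 0 ≤ ε i) (ht : ∀ i, 0 ≤ t i) (h : MemMultiHat C e p ι x ε t) :
    MemMulti C e p ι x (fun k => countBefore k * ε k) (fun k => countBefore k * t k) := by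
  have hC := hos.toIsMatrixOrdering
  have hP := hC.sum_mem hos.unit_mem Finset.univ _ fun k _ =>
    hC.smul_mem _ (ε k) (hε k) _ (hC.count_smul_sub_mem (hp k).1 (hp k).2 k ι)
  have hQ := hC.sum_mem hos.unit_mem Finset.univ _ fun k _ =>
    hC.smul_mem _ (t k) (ht k) _ (hC.count_smul_sub_mem (hp k).2 (hp k).1 k ι)
  have hsum := hC.add_mem _ _ (hC.add_mem _ _ h _ hP) _ hQ
  unfold MemMulti
  convert hsum using 1
  simp only [smul_sub, Finset.sum_sub_distrib, smul_smul, Complex.ofReal_mul, mul_comm, Pm, Qm,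
    PmHat, QmHat]
  abel

end Comparison

/-- `Ĉ(p_1,…,p_N)_n ⊆ C(p_1,…,p_N)_n`. -/
theorem stmt_2 {V : Type} [AddCommGroup V] [Module ℂ V] [StarAddMonoid V] [StarModule ℂ V]
    (C : ConeFamily V) (e : V) (hos : IsOperatorSystem C e)
    {N : ℕ} (hN : 1 ≤ N) (p : Fin N → V) (hp : ∀ i, IsPosCon C e (p i))
    (n : ℕ) (hn : 1 ≤ n) :
    coneMultiHat C e p (Fin n) ⊆ coneMulti C e p (Fin n) := by
  rintro x ⟨hx, H⟩
  refine ⟨hx, fun ε hε => ?_⟩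
  have hm := countBefore_pos (N := N)
  have hε₀ : ∀ i, 0 < ε i / countBefore i := fun i => div_pos (hε i) (hm i)
  have hcancel : ∀ (i : Fin N) (r : ℝ), countBefore i * (r / countBefore i) = r :=
    fun i r => mul_div_cancel₀ r (hm i).ne'
  obtain ⟨t, ht, hmem, hupd⟩ := H (fun i => ε i / countBefore i) hε₀
  refine ⟨fun i => countBefore i * t i, fun i => mul_pos (hm i) (ht i), ?_, ?_⟩
  · simpa only [hcancel] using hmem.memMulti hos hp (fun i => (hε₀ i).le) (fun i => (ht i).le)
  · intro i ε' hε' hlt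
    obtain ⟨t', ht', hmem'⟩ :=
      hupd i (ε' / countBefore i) (div_pos hε' (hm i)) (div_lt_div_of_pos_right hlt (hm i))
    refine ⟨countBefore i * t', mul_lt_mul_of_pos_left ht' (hm i), ?_⟩
    have hnonneg : ∀ {f : Fin N → ℝ} {r : ℝ}, (∀ j, 0 < f j) → 0 < r →
        ∀ j, 0 ≤ Function.update f i r j := by
      intro f r hf hr j
      rcases eq_or_ne j i with rfl | hj
      · simpa using hr.le
      · simpa [hj] using (hf j).le
    convert hmem'.memMulti hos hp (hnonneg hε₀ (div_pos hε' (hm i)))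
      (hnonneg ht ((ht i).trans ht')) using 1 <;>
    · ext j
      rcases eq_or_ne j i with rfl | hj
      · simp [hcancel]
      · simp [hj, hcancel]
end

section
/- Let (V, C, e) be an operator system and let p_1, …, p_N ∈ V be positive contractions. Then for every n ≥ 1, L ≥ 1, and hermitian x ∈ M_n(V): if x ⊗ J_{2^{NL}} ∈ C(p_1, …, p_N)^L_n, then x ⊗ J_{2^{N(L+1)}} ∈ C(p_1, …, p_N)^{L+1}_n. (Thus the pullbacks of the cones C(p_1, …, p_N)^L along the maps x ↦ x ⊗ J_{2^{NL}} form a nested increasing sequence of matrix orderings on V.) -/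
open scoped ComplexOrder

section LevelL

variable {V : Type} [AddCommGroup V] [Module ℂ V] [StarAddMonoid V] [StarModule ℂ V] {N : ℕ}

/-- `P_{i,j}^{N,L} = I_{2^{N(j-1)}} ⊗ P_i^N ⊗ J_{2^{N(L-j)}}`, indexed by `L`-tuples of
binary strings of length `N`. -/
def PmL (e : V) (p : Fin N → V) {L : ℕ} (i : Fin N) (j : Fin L) :
    Matrix (Fin L → Fin N → Fin 2) (Fin L → Fin N → Fin 2) V :=
  Matrix.of fun σ τ => if ∀ l, l < j → σ l = τ l then Pm e p i (σ j) (τ j) else 0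

/-- `Q_{i,j}^{N,L} = I_{2^{N(j-1)}} ⊗ Q_i^N ⊗ J_{2^{N(L-j)}}`. -/
def QmL (e : V) (p : Fin N → V) {L : ℕ} (i : Fin N) (j : Fin L) :
    Matrix (Fin L → Fin N → Fin 2) (Fin L → Fin N → Fin 2) V :=
  Matrix.of fun σ τ => if ∀ l, l < j → σ l = τ l then Qm e p i (σ j) (τ j) else 0

/-- `x + Σ_{i,j} ε_{i,j} (I_ι ⊗ P_{i,j}^{N,L}) + Σ_{i,j} t_{i,j} (I_ι ⊗ Q_{i,j}^{N,L})
∈ C_{ι·2^{NL}}`. -/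
def MemL (C : ConeFamily V) (e : V) (p : Fin N → V) (L : ℕ)
    (ι : Type) [Fintype ι] [DecidableEq ι]
    (x : Matrix (ι × (Fin L → Fin N → Fin 2)) (ι × (Fin L → Fin N → Fin 2)) V)
    (ε t : Fin N × Fin L → ℝ) : Prop :=
  x + ∑ q : Fin N × Fin L, (ε q : ℂ) • idKron (PmL e p q.1 q.2)
    + ∑ q : Fin N × Fin L, (t q : ℂ) • idKron (QmL e p q.1 q.2)
    ∈ C (ι × (Fin L → Fin N → Fin 2))

/-- the cone `C(p_1, …, p_N)^L_ι ⊆ M_{ι·2^{NL}}(V)`. -/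
def coneL (C : ConeFamily V) (e : V) (p : Fin N → V) (L : ℕ)
    (ι : Type) [Fintype ι] [DecidableEq ι] :
    Set (Matrix (ι × (Fin L → Fin N → Fin 2)) (ι × (Fin L → Fin N → Fin 2)) V) :=
  {x | IsHermMat x ∧ ∀ ε : Fin N × Fin L → ℝ, (∀ q, 0 < ε q) →
    ∃ t : Fin N × Fin L → ℝ, (∀ q, 0 < t q) ∧ MemL C e p L ι x ε t ∧
      ∀ (q : Fin N × Fin L) (ε' : ℝ), 0 < ε' → ε' < ε q →
        ∃ t' : ℝ, t q < t' ∧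
          MemL C e p L ι x (Function.update ε q ε') (Function.update t q t')}

/-- the inductive-limit cone `C(p_1, …, p_N)^∞_ι ⊆ M_ι(V)`. -/
def coneInf (C : ConeFamily V) (e : V) (p : Fin N → V)
    (ι : Type) [Fintype ι] [DecidableEq ι] : Set (Matrix ι ι V) :=
  {x | IsHermMat x ∧ ∀ ε : ℝ, 0 < ε → ∃ L : ℕ, 1 ≤ L ∧
    onesKron (κ := Fin L → Fin N → Fin 2) (x + (ε : ℂ) • unitMat e)
      ∈ coneL C e p L ι}

/-- `C(p_1, …, p_N)^∞` as a family of cones. -/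
def coneInfFam (C : ConeFamily V) (e : V) (p : Fin N → V) : ConeFamily V :=
  fun ι _ _ => coneInf C e p ι

end LevelL

section ConeClosure

variable {V : Type} [AddCommGroup V] [Module ℂ V] [StarAddMonoid V]
  {C : ConeFamily V} {e : V}

theorem IsMatrixOrdering.submatrix_mem (hC : IsMatrixOrdering C) {ι κ : Type} [Fintype ι]
    [DecidableEq ι] [Fintype κ] [DecidableEq κ] (r : κ → ι) {x : Matrix ι ι V} (hx : x ∈ C ι) :
    x.submatrix r r ∈ C κ := by
  convert hC.conj_mem ι κ (Matrix.of fun i s => if i = r s then 1 else 0) x hx using 1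
  ext s t
  simp [conjBy]

theorem IsOperatorSystem.zero_mem (hos : IsOperatorSystem C e) (κ : Type) [Fintype κ]
    [DecidableEq κ] : (0 : Matrix κ κ V) ∈ C κ := by
  convert hos.conj_mem (Fin 1) κ 0 _ hos.unit_mem using 1
  ext s t
  simp [conjBy]

theorem IsOperatorSystem.sum_mem (hos : IsOperatorSystem C e) {κ γ : Type} [Fintype κ]
    [DecidableEq κ] (s : Finset γ) (f : γ → Matrix κ κ V) (hf : ∀ c ∈ s, f c ∈ C κ) :
    ∑ c ∈ s, f c ∈ C κ :=
  Finset.sum_induction f (· ∈ C κ) (fun a b ha hb => hos.add_mem κ a ha b hb)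
    (hos.zero_mem κ) hf

theorem IsOperatorSystem.diagonal_mem (hos : IsOperatorSystem C e) {γ : Type} [Fintype γ]
    [DecidableEq γ] {d : γ → V} (hd : ∀ c, Mem1 C (d c)) : Matrix.diagonal d ∈ C γ := by
  have h := hos.sum_mem Finset.univ _ fun c _ =>
    hos.conj_mem (Fin 1) γ (Matrix.of fun _ s => if s = c then 1 else 0) _ (hd c)
  convert h using 1
  ext s t
  rw [Matrix.sum_apply]
  by_cases hst : s = t
  · subst hst
    simp [conjBy]
  · simp [conjBy, hst]

end ConeClosure

section LevelSucc

variable {V : Type} [AddCommGroup V] [Module ℂ V] [StarAddMonoid V]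
  {C : ConeFamily V} {e : V} {N : ℕ} {p : Fin N → V}

theorem QmL_eq_PmL_compl {V : Type} [AddCommGroup V] (e : V) (p : Fin N → V) {L : ℕ}
    (i : Fin N) (j : Fin L) :
    QmL e p i j = PmL e (fun k => e - p k) i j := by
  ext σ τ
  simp [QmL, PmL, Qm, Pm]

theorem IsPosCon.compl {V : Type} [AddCommGroup V] {C : ConeFamily V} {e q : V}
    (hq : IsPosCon C e q) : IsPosCon C e (e - q) :=
  ⟨hq.2, by simpa using hq.1⟩

theorem IsOperatorSystem.idKron_PmL_mem (hos : IsOperatorSystem C e)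
    (hp : ∀ i, IsPosCon C e (p i)) {L : ℕ} (ι : Type) [Fintype ι] [DecidableEq ι]
    (i : Fin N) (j : Fin L) :
    idKron (ι := ι) (PmL e p i j) ∈ C (ι × (Fin L → Fin N → Fin 2)) := by
  let d : ι × (Fin L → Fin N → Fin 2) × (Fin N → Fin 2) × Fin 2 → V :=
    fun c => if c.2.2.2 = 0 then p i else e - p i
  have hd : ∀ c, Mem1 C (d c) := fun c => by
    dsimp only [d]
    split_ifs
    exacts [(hp i).1, (hp i).2]
  convert hos.submatrix_mem
    (fun a : ι × (Fin L → Fin N → Fin 2) =>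
      (a.1, (fun l => if l < j then a.2 l else 0), (fun k => if k < i then a.2 j k else 0),
        a.2 j i)) (hos.diagonal_mem hd) using 1
  ext ⟨a, σ⟩ ⟨b, τ⟩
  have h₁ : ((fun l => if l < j then σ l else 0) = fun l => if l < j then τ l else 0) ↔
      ∀ l, l < j → σ l = τ l := by
    rw [funext_iff]
    exact forall_congr' fun l => by split_ifs with hl <;> simp [hl]
  have h₂ : ((fun k => if k < i then σ j k else 0) = fun k => if k < i then τ j k else 0) ↔
      ∀ k, k < i → σ j k = τ j k := by
    rw [funext_iff]
    exact forall_congr' fun k => by split_ifs with hk <;> simp [hk]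
  simp only [idKron, PmL, Pm, Matrix.of_apply, Matrix.submatrix_apply, Matrix.diagonal_apply,
    Prod.mk.injEq, h₁, h₂, ite_and, d]

theorem PmL_castSucc {V : Type} [AddCommGroup V] (e : V) (p : Fin N → V) {L : ℕ}
    (i : Fin N) (j : Fin L) :
    PmL e p i j.castSucc = (PmL e p i j).submatrix Fin.init Fin.init := by
  ext σ τ
  simp [PmL, Fin.init, Fin.forall_fin_succ', Fin.castSucc_lt_castSucc_iff,
    (Fin.castSucc_lt_last j).le]
  congr

theorem QmL_castSucc {V : Type} [AddCommGroup V] (e : V) (p : Fin N → V) {L : ℕ}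
    (i : Fin N) (j : Fin L) :
    QmL e p i j.castSucc = (QmL e p i j).submatrix Fin.init Fin.init := by
  simp only [QmL_eq_PmL_compl, PmL_castSucc]

theorem MemL.succ (hos : IsOperatorSystem C e) (hp : ∀ i, IsPosCon C e (p i)) {L : ℕ}
    {ι : Type} [Fintype ι] [DecidableEq ι] {x : Matrix ι ι V}
    {ε t : Fin N × Fin (L + 1) → ℝ} (hε : ∀ i, 0 ≤ ε (i, Fin.last L))
    (ht : ∀ i, 0 ≤ t (i, Fin.last L))
    (h : MemL C e p L ι (onesKron x) (fun q => ε (q.1, q.2.castSucc))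
      fun q => t (q.1, q.2.castSucc)) :
    MemL C e p (L + 1) ι (onesKron x) ε t := by
  unfold MemL at h ⊢
  have hlift := hos.submatrix_mem
    (fun a : ι × (Fin (L + 1) → Fin N → Fin 2) => (a.1, (Fin.init a.2 : Fin L → Fin N → Fin 2))) h
  have hP := hos.sum_mem Finset.univ _ fun i _ =>
    hos.smul_mem _ _ (hε i) _ (hos.idKron_PmL_mem hp ι i (Fin.last L))
  have hQ := hos.sum_mem Finset.univ _ fun i _ =>
    hos.smul_mem _ _ (ht i) _ (hos.idKron_PmL_mem (fun i => (hp i).compl) ι i (Fin.last L))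
  simp only [← QmL_eq_PmL_compl] at hQ
  convert hos.add_mem _ _ (hos.add_mem _ _ hlift _ hP) _ hQ using 1
  simp only [Fintype.sum_prod_type, Fin.sum_univ_castSucc, Finset.sum_add_distrib,
    PmL_castSucc, QmL_castSucc]
  ext a b
  simp only [Matrix.add_apply, Matrix.sum_apply, Matrix.smul_apply, Matrix.submatrix_apply,
    onesKron, idKron, Matrix.of_apply]
  abel

end LevelSucc

/-- the pullbacks of the cones `C(p_1,…,p_N)^L` along `x ↦ x ⊗ J_{2^{NL}}`
are nested increasing. -/
theorem stmt_7 {V : Type} [AddCommGroup V] [Module ℂ V] [StarAddMonoid V] [StarModule ℂ V]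
    (C : ConeFamily V) (e : V) (hos : IsOperatorSystem C e)
    {N : ℕ} (hN : 1 ≤ N) (p : Fin N → V) (hp : ∀ i, IsPosCon C e (p i))
    (n L : ℕ) (hn : 1 ≤ n) (hL : 1 ≤ L)
    (x : Matrix (Fin n) (Fin n) V) (hx : IsHermMat x)
    (h : onesKron (κ := Fin L → Fin N → Fin 2) x ∈ coneL C e p L (Fin n)) :
    onesKron (κ := Fin (L + 1) → Fin N → Fin 2) x ∈ coneL C e p (L + 1) (Fin n) := by
  refine ⟨fun a b => hx a.1 b.1, fun ε hε => ?_⟩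
  obtain ⟨t, ht, hmem, hupd⟩ := h.2 (fun q => ε (q.1, q.2.castSucc)) fun q => hε _
  let T : Fin N × Fin (L + 1) → ℝ := fun q =>
    Fin.lastCases (motive := fun _ => ℝ) 1 (fun j => t (q.1, j)) q.2
  have hTcast : (fun q : Fin N × Fin L => T (q.1, q.2.castSucc)) = t := by
    funext q
    simp [T]
  have hTlast : ∀ i, T (i, Fin.last L) = 1 := fun i => by simp [T]
  have hinj : Function.Injective fun q : Fin N × Fin L => (q.1, q.2.castSucc) := fun a b hab => by
    simpa [Prod.ext_iff] using hab
  refine ⟨T, ?_, MemL.succ hos hp (fun i => (hε _).le) (fun i => by simp [hTlast])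
    (by rwa [hTcast]), ?_⟩
  · rintro ⟨i, j⟩
    induction j using Fin.lastCases with
    | last => simp [hTlast]
    | cast j => simpa [T] using ht (i, j)
  · rintro ⟨i, j⟩ ε' hε' hlt
    induction j using Fin.lastCases with
    | last =>
      refine ⟨2, by simp [hTlast], MemL.succ hos hp (fun k => ?_) (fun k => ?_) ?_⟩
      · rw [Function.update_apply]
        split_ifs
        exacts [hε'.le, (hε _).le]
      · rw [Function.update_apply]
        split_ifs
        exacts [zero_le_two, by simp [hTlast]]
      · have hne : ∀ q : Fin N × Fin L, (q.1, q.2.castSucc) ≠ (i, Fin.last L) := fun q hq =>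
          (Fin.castSucc_lt_last q.2).ne (Prod.ext_iff.1 hq).2
        simp only [Function.update_of_ne (hne _)]
        rwa [hTcast]
    | cast j =>
      obtain ⟨t', ht', hmem'⟩ := hupd (i, j) ε' hε' hlt
      have hne : ∀ k, (k, Fin.last L) ≠ (i, j.castSucc) := fun k hk =>
        (Fin.castSucc_lt_last j).ne' (Prod.ext_iff.1 hk).2
      refine ⟨t', by simpa [T] using ht', MemL.succ hos hp (fun k => ?_) (fun k => ?_) ?_⟩
      · rw [Function.update_of_ne (hne k)]
        exact (hε _).le
      · simp [Function.update_of_ne (hne k), hTlast]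
      · have hcomp := fun (f : Fin N × Fin (L + 1) → ℝ) (a : ℝ) =>
          Function.update_comp_eq_of_injective f hinj (i, j) a
        simp only [Function.comp_def] at hcomp
        rw [hcomp, hcomp, hTcast]
        exact hmem'
end

section
/- Fix n, k ≥ 1 and let V_ns be the universal nonsignalling vector space with generators Q(a,b|x,y). Then: (a) the complex dimension of V_ns equals (n(k−1)+1)²; (b) V_ns has the following universal property: for every complex vector space W and every family of vectors q(a,b|x,y) ∈ W (a,b ∈ [k], x,y ∈ [n]) such that Σ_{a,b} q(a,b|x,y) is independent of (x,y), Σ_c q(a,c|x,z) is independent of z for each a, x, and Σ_d q(d,b|z,y) is independent of z for each b, y, there exists a unique linear map φ: V_ns → W with φ(Q(a,b|x,y)) = q(a,b|x,y) for all a,b,x,y. -/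
namespace NSpace

variable (n k : ℕ)

/-- index set for the generators `Q̃(a,b|x,y)`. -/
abbrev Idx (n k : ℕ) := Fin k × Fin k × Fin n × Fin n

/-- the free vector space `W̃ = ℂ^{k²n²}`. -/
abbrev Wt (n k : ℕ) := Idx n k → ℂ

/-- the canonical basis vector `Q̃(a,b|x,y)`. -/
def gen {n k : ℕ} (a b : Fin k) (x y : Fin n) : Wt n k := Pi.single (a, b, x, y) 1

/-- the set of nonsignalling relations. -/
def relSet (n k : ℕ) : Set (Wt n k) :=
  {u | ∃ x y x' y', u = (∑ a, ∑ b, gen a b x y) - (∑ a, ∑ b, gen a b x' y')} ∪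
  {u | ∃ a x z w, u = (∑ c, gen a c x z) - (∑ c, gen a c x w)} ∪
  {u | ∃ b y z w, u = (∑ d, gen d b z y) - (∑ d, gen d b w y)}

/-- the subspace `J` spanned by the nonsignalling relations. -/
noncomputable def Jrel (n k : ℕ) : Submodule ℂ (Wt n k) := Submodule.span ℂ (relSet n k)

/-- the universal nonsignalling vector space `V_ns = W̃ / J`. -/
abbrev Vns (n k : ℕ) := Wt n k ⧸ Jrel n k

/-- the generator `Q(a,b|x,y) = Q̃(a,b|x,y) + J` of `V_ns`. -/
noncomputable def Qg {n k : ℕ} (a b : Fin k) (x y : Fin n) : Vns n k :=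
  Submodule.Quotient.mk (gen a b x y)

/-- the unit `e_ns = Σ_{a,b} Q(a,b|x,y)` of `V_ns`. -/
noncomputable def ens (n k : ℕ) [NeZero n] : Vns n k := ∑ a, ∑ b, Qg (n := n) (k := k) a b 0 0

/-- the coordinatewise conjugation on `W̃`. -/
def starW (n k : ℕ) : Wt n k → Wt n k := fun w i => (starRingEnd ℂ) (w i)

theorem starW_gen {n k : ℕ} (a b : Fin k) (x y : Fin n) :
    starW n k (gen a b x y) = gen a b x y := by
  funext i
  by_cases h : i = (a, b, x, y) <;> simp [starW, gen, Pi.single_apply, h]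

theorem starW_mem_Jrel {n k : ℕ} {u : Wt n k} (hu : u ∈ Jrel n k) :
    starW n k u ∈ Jrel n k := by
  have hsub : ∀ u v : Wt n k, starW n k (u - v) = starW n k u - starW n k v := by
    intro u v; funext i; simp [starW]
  have hsum : ∀ {α : Type} (s : Finset α) (f : α → Wt n k),
      starW n k (∑ j ∈ s, f j) = ∑ j ∈ s, starW n k (f j) := by
    intro α s f; funext i
    simp [starW, Finset.sum_apply, map_sum]
  induction hu using Submodule.span_induction with
  | mem s hs =>
    have hfix : starW n k s = s := by
      rcases hs with (⟨x, y, x', y', rfl⟩ | ⟨a, x, z, w, rfl⟩) | ⟨b, y, z, w, rfl⟩ <;>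
        simp [hsub, hsum, starW_gen]
    rw [hfix]; exact Submodule.subset_span hs
  | zero =>
    have : starW n k 0 = 0 := by funext i; simp [starW]
    rw [this]; exact zero_mem _
  | add u v _ _ ihu ihv =>
    have : starW n k (u + v) = starW n k u + starW n k v := by
      funext i; simp [starW]
    rw [this]; exact add_mem ihu ihv
  | smul c u _ ih =>
    have : starW n k (c • u) = (starRingEnd ℂ) c • starW n k u := by
      funext i; simp [starW]
    rw [this]; exact Submodule.smul_mem _ _ ih

/-- the conjugate-linear involution on `V_ns` fixing each generator. -/
noncomputable def starVns {n k : ℕ} : Vns n k → Vns n k := fun v =>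
  Quotient.liftOn' v
    (fun w => (Submodule.Quotient.mk (starW n k w) : Vns n k))
    (fun a b hab => by
      rw [Submodule.quotientRel_def] at hab
      apply Quotient.sound'
      rw [Submodule.quotientRel_def]
      have h : starW n k a - starW n k b = starW n k (a - b) := by
        funext i; simp [starW]
      rw [h]
      exact starW_mem_Jrel hab)

noncomputable instance {n k : ℕ} : StarAddMonoid (Vns n k) where
  star := starVns
  star_involutive := by
    intro v
    obtain ⟨w, rfl⟩ := Submodule.Quotient.mk_surjective _ v
    show Submodule.Quotient.mk (starW n k (starW n k w)) = Submodule.Quotient.mk w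
    congr 1
    funext i; simp [starW]
  star_add := by
    intro v v'
    obtain ⟨w, rfl⟩ := Submodule.Quotient.mk_surjective _ v
    obtain ⟨w', rfl⟩ := Submodule.Quotient.mk_surjective _ v'
    show Submodule.Quotient.mk (starW n k (w + w')) =
      (Submodule.Quotient.mk (starW n k w) : Vns n k) + Submodule.Quotient.mk (starW n k w')
    rw [← Submodule.Quotient.mk_add]
    congr 1
    funext i; simp [starW]

instance {n k : ℕ} : StarModule ℂ (Vns n k) where
  star_smul := by
    intro c v
    obtain ⟨w, rfl⟩ := Submodule.Quotient.mk_surjective _ v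
    show Submodule.Quotient.mk (starW n k (c • w)) =
      star c • (Submodule.Quotient.mk (starW n k w) : Vns n k)
    rw [← Submodule.Quotient.mk_smul]
    congr 1
    funext i; simp [starW, mul_comm]

theorem star_Qg {n k : ℕ} (a b : Fin k) (x y : Fin n) :
    star (Qg a b x y) = Qg a b x y := by
  show Submodule.Quotient.mk (starW n k (gen a b x y)) = Qg a b x y
  rw [starW_gen]; rfl

/-- the cone `D_ns` generated by the generators `Q(a,b|x,y)`. -/
def Dns (n k : ℕ) : Set (Vns n k) :=
  {v | ∃ t : Idx n k → ℝ, (∀ i, 0 ≤ t i) ∧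
    v = ∑ i : Idx n k, (t i : ℂ) • Qg i.1 i.2.1 i.2.2.1 i.2.2.2}

end NSpace

namespace NSpace

theorem exists_lift_Vns {n k : ℕ} {W : Type*} [AddCommGroup W] [Module ℂ W]
    (q : Fin k → Fin k → Fin n → Fin n → W)
    (h₁ : ∀ x y x' y', ∑ a, ∑ b, q a b x y = ∑ a, ∑ b, q a b x' y')
    (h₂ : ∀ a x z w, ∑ c, q a c x z = ∑ c, q a c x w)
    (h₃ : ∀ b y z w, ∑ d, q d b z y = ∑ d, q d b w y) :
    ∃ φ : Vns n k →ₗ[ℂ] W, ∀ a b x y, φ (Qg a b x y) = q a b x y := by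
  let f : Wt n k →ₗ[ℂ] W :=
    Fintype.linearCombination ℂ fun i : Idx n k => q i.1 i.2.1 i.2.2.1 i.2.2.2
  have hf : ∀ a b x y, f (gen a b x y) = q a b x y := fun a b x y => by
    simp [f, gen]
  have hJ : Jrel n k ≤ LinearMap.ker f := by
    refine Submodule.span_le.2 ?_
    rintro u ((⟨x, y, x', y', rfl⟩ | ⟨a, x, z, w, rfl⟩) | ⟨b, y, z, w, rfl⟩)
    · simpa [hf, sub_eq_zero] using h₁ x y x' y'
    · simpa [hf, sub_eq_zero] using h₂ a x z w
    · simpa [hf, sub_eq_zero] using h₃ b y z w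
  exact ⟨(Jrel n k).liftQ f hJ, fun a b x y => by simp [Qg, hf]⟩

theorem Qg_eq_mkQ {n k : ℕ} (a b : Fin k) (x y : Fin n) :
    Qg a b x y = (Jrel n k).mkQ (gen a b x y) := rfl

theorem span_Qg (n k : ℕ) :
    Submodule.span ℂ (Set.range fun i : Idx n k => Qg i.1 i.2.1 i.2.2.1 i.2.2.2) = ⊤ := by
  have h := congrArg (Submodule.map (Jrel n k).mkQ) (Pi.basisFun ℂ (Idx n k)).span_eq
  rw [Submodule.map_span, Submodule.map_top, Submodule.range_mkQ, ← Set.range_comp] at h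
  have hQ : (fun i : Idx n k => Qg i.1 i.2.1 i.2.2.1 i.2.2.2) =
      (Jrel n k).mkQ ∘ Pi.basisFun ℂ (Idx n k) := by
    funext i
    simp [Qg, gen]
  rw [hQ, h]

theorem hom_ext_Vns {n k : ℕ} {W : Type*} [AddCommGroup W] [Module ℂ W]
    {φ ψ : Vns n k →ₗ[ℂ] W} (h : ∀ a b x y, φ (Qg a b x y) = ψ (Qg a b x y)) : φ = ψ :=
  LinearMap.ext_on_range (span_Qg n k) fun i => h i.1 i.2.1 i.2.2.1 i.2.2.2

theorem Qg_sum_right {n k : ℕ} (a : Fin k) (x z w : Fin n) :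
    ∑ c, Qg a c x z = ∑ c, Qg a c x w := by
  have h : (∑ c, gen a c x z) - (∑ c, gen a c x w) ∈ Jrel n k :=
    Submodule.subset_span (Or.inl (Or.inr ⟨a, x, z, w, rfl⟩))
  simp only [Qg_eq_mkQ, ← map_sum]
  exact (Submodule.Quotient.eq (Jrel n k)).2 h

theorem Qg_sum_left {n k : ℕ} (b : Fin k) (y z w : Fin n) :
    ∑ d, Qg d b z y = ∑ d, Qg d b w y := by
  have h : (∑ d, gen d b z y) - (∑ d, gen d b w y) ∈ Jrel n k :=
    Submodule.subset_span (Or.inr ⟨b, y, z, w, rfl⟩)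
  simp only [Qg_eq_mkQ, ← map_sum]
  exact (Submodule.Quotient.eq (Jrel n k)).2 h

theorem Qg_sum_sum {n k : ℕ} (x y x' y' : Fin n) :
    ∑ a : Fin k, ∑ b, Qg a b x y = ∑ a, ∑ b, Qg a b x' y' := by
  have h : (∑ a, ∑ b, gen a b x y) - (∑ a, ∑ b, gen a b x' y') ∈ Jrel n k :=
    Submodule.subset_span (Or.inl (Or.inl ⟨x, y, x', y', rfl⟩))
  simp only [Qg_eq_mkQ, ← map_sum]
  exact (Submodule.Quotient.eq (Jrel n k)).2 h

/-- Index set for a basis of the space of one party: the unit, and for each input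
all outputs but the first. -/
abbrev LocalIdx (n m : ℕ) := Option (Fin n × Fin m)

/-- The vector of outcome `a` on input `x` in the space of one party. -/
noncomputable def localVec {n m : ℕ} (a : Fin (m + 1)) (x : Fin n) : LocalIdx n m → ℂ :=
  Fin.cases (Pi.single none 1 - ∑ c : Fin m, Pi.single (some (x, c)) 1)
    (fun c => Pi.single (some (x, c)) 1) a

theorem localVec_succ {n m : ℕ} (c : Fin m) (x : Fin n) :
    localVec c.succ x = Pi.single (some (x, c)) 1 := rfl

theorem sum_localVec {n m : ℕ} (x : Fin n) :
    ∑ a : Fin (m + 1), localVec a x = Pi.single none 1 := by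
  simp [Fin.sum_univ_succ, localVec]

theorem sum_localVec_apply {n m : ℕ} (x : Fin n) (i : LocalIdx n m) :
    ∑ a : Fin (m + 1), localVec a x i = (Pi.single none 1 : LocalIdx n m → ℂ) i := by
  rw [← sum_localVec x, Finset.sum_apply]

/-- The candidate basis of `V_ns`. -/
noncomputable def basisVec {n m : ℕ} [NeZero n] : LocalIdx n m × LocalIdx n m → Vns n (m + 1)
  | (none, none) => ens n (m + 1)
  | (none, some (y, b)) => ∑ c, Qg c b.succ 0 y
  | (some (x, a), none) => ∑ d, Qg a.succ d x 0
  | (some (x, a), some (y, b)) => Qg a.succ b.succ x y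

theorem linearIndependent_basisVec (n m : ℕ) [NeZero n] :
    LinearIndependent ℂ (basisVec (n := n) (m := m)) := by
  obtain ⟨ψ, hψ⟩ := exists_lift_Vns (n := n) (k := m + 1)
    (fun a b x y => fun i : LocalIdx n m × LocalIdx n m => localVec a x i.1 * localVec b y i.2)
    (fun x y x' y' => by
      funext i
      simp [Finset.sum_apply, ← Finset.mul_sum, ← Finset.sum_mul, sum_localVec_apply])
    (fun a x z w => by
      funext i
      simp [Finset.sum_apply, ← Finset.mul_sum, sum_localVec_apply])
    (fun b y z w => by
      funext i
      simp [Finset.sum_apply, ← Finset.sum_mul, sum_localVec_apply])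
  have hbasis : ⇑ψ ∘ basisVec = Pi.basisFun ℂ (LocalIdx n m × LocalIdx n m) := by
    have hsingle : ∀ i j : LocalIdx n m, (fun l : LocalIdx n m × LocalIdx n m =>
        (Pi.single i 1 : LocalIdx n m → ℂ) l.1 * (Pi.single j 1 : LocalIdx n m → ℂ) l.2) =
          Pi.single (i, j) 1 := by
      intro i j
      funext l
      simp only [Pi.single_apply, Prod.ext_iff]
      split_ifs <;> simp_all
    funext ij
    rw [Pi.basisFun_apply]
    obtain ⟨i, j⟩ := ij
    rw [← hsingle]
    rcases i with _ | ⟨x, a⟩ <;> rcases j with _ | ⟨y, b⟩ <;> funext l <;>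
      simp [basisVec, ens, hψ, Finset.sum_apply, ← Finset.mul_sum, ← Finset.sum_mul,
        sum_localVec_apply, localVec_succ]
  refine LinearIndependent.of_comp ψ ?_
  rw [hbasis]
  exact (Pi.basisFun ℂ _).linearIndependent

theorem mem_of_succ_mem_of_sum_mem {R M : Type*} [Ring R] [AddCommGroup M] [Module R M] {m : ℕ}
    {S : Submodule R M} {f : Fin (m + 1) → M} (hsucc : ∀ c : Fin m, f c.succ ∈ S)
    (hsum : ∑ c, f c ∈ S) (a : Fin (m + 1)) : f a ∈ S := by
  refine Fin.cases ?_ hsucc a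
  rw [Fin.sum_univ_succ] at hsum
  exact (S.add_mem_iff_left (S.sum_mem fun c _ => hsucc c)).1 hsum

theorem span_basisVec (n m : ℕ) [NeZero n] :
    Submodule.span ℂ (Set.range (basisVec (n := n) (m := m))) = ⊤ := by
  set S := Submodule.span ℂ (Set.range (basisVec (n := n) (m := m)))
  have hmem : ∀ ij, basisVec ij ∈ S := fun ij => Submodule.subset_span ⟨ij, rfl⟩
  have hsucc : ∀ (a : Fin m) b (x y : Fin n), Qg a.succ b x y ∈ S := fun a b x y =>
    mem_of_succ_mem_of_sum_mem (f := fun b => Qg a.succ b x y)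
      (fun c => hmem (some (x, a), some (y, c)))
      (Qg_sum_right a.succ x 0 y ▸ hmem (some (x, a), none)) b
  have hsum : ∀ b (x y : Fin n), ∑ a : Fin (m + 1), Qg a b x y ∈ S := fun b x y =>
    mem_of_succ_mem_of_sum_mem (f := fun b => ∑ a : Fin (m + 1), Qg a b x y)
      (fun c => Qg_sum_left c.succ y 0 x ▸ hmem (none, some (y, c)))
      (by
        rw [Finset.sum_comm, Qg_sum_sum x y 0 0]
        exact hmem (none, none)) b
  rw [eq_top_iff, ← span_Qg, Submodule.span_le]
  rintro _ ⟨⟨a, b, x, y⟩, rfl⟩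
  exact mem_of_succ_mem_of_sum_mem (f := fun a => Qg a b x y)
    (fun c => hsucc c b x y) (hsum b x y) a

theorem finrank_Vns (n m : ℕ) [NeZero n] :
    Module.finrank ℂ (Vns n (m + 1)) = (n * m + 1) ^ 2 := by
  rw [Module.finrank_eq_card_basis
    (Module.Basis.mk (linearIndependent_basisVec n m) (span_basisVec n m).ge)]
  simp [sq]

end NSpace

open NSpace

/-- dimension and universal property of the universal nonsignalling
vector space. -/
theorem stmt_13 (n k : ℕ) [NeZero n] [NeZero k] :
    Module.finrank ℂ (Vns n k) = (n * (k - 1) + 1) ^ 2 ∧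
    (∀ (W : Type) [AddCommGroup W] [Module ℂ W]
      (q : Fin k → Fin k → Fin n → Fin n → W),
      (∀ x y x' y', ∑ a, ∑ b, q a b x y = ∑ a, ∑ b, q a b x' y') →
      (∀ a x z w, ∑ c, q a c x z = ∑ c, q a c x w) →
      (∀ b y z w, ∑ d, q d b z y = ∑ d, q d b w y) →
      ∃! φ : Vns n k →ₗ[ℂ] W, ∀ a b x y, φ (Qg a b x y) = q a b x y) := by
  refine ⟨?_, fun W _ _ q h₁ h₂ h₃ => ?_⟩
  · obtain ⟨m, rfl⟩ := Nat.exists_eq_succ_of_ne_zero (NeZero.ne k)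
    exact finrank_Vns n m
  · obtain ⟨φ, hφ⟩ := exists_lift_Vns q h₁ h₂ h₃
    exact ⟨φ, hφ, fun ψ hψ => hom_ext_Vns fun a b x y => (hψ a b x y).trans (hφ a b x y).symm⟩
end

section
/- Fix n, k ≥ 1 and let V_ns be the universal nonsignalling vector space with generators Q(a,b|x,y), unit e_ns, and cone D_ns. Let p(a,b|x,y) (a,b ∈ [k], x,y ∈ [n]) be a correlation. Then p is nonsignalling if and only if there exists a linear functional φ: V_ns → ℂ with φ(e_ns) = 1 and φ(v) a nonnegative real for every v ∈ D_ns, such that p(a,b|x,y) = φ(Q(a,b|x,y)) for all a,b ∈ [k] and x,y ∈ [n]. -/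
open scoped ComplexOrder
open NSpace

/-- a correlation with `n` inputs and `k` outputs. -/
def IsCorrelation (n k : ℕ) (p : Fin k → Fin k → Fin n → Fin n → ℝ) : Prop :=
  (∀ a b x y, 0 ≤ p a b x y) ∧ ∀ x y, ∑ a, ∑ b, p a b x y = 1

/-- a nonsignalling correlation. -/
def IsNSCorrelation (n k : ℕ) (p : Fin k → Fin k → Fin n → Fin n → ℝ) : Prop :=
  IsCorrelation n k p ∧
  (∀ a x w w', ∑ d, p a d x w = ∑ d, p a d x w') ∧
  (∀ b y z z', ∑ c, p c b z y = ∑ c, p c b z' y)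

namespace NSpace

/-- the linear functional on `W̃` whose value on `Q̃(a,b|x,y)` is `p(a,b|x,y)`. -/
noncomputable def evalW {n k : ℕ} (p : Fin k → Fin k → Fin n → Fin n → ℝ) : Wt n k →ₗ[ℂ] ℂ :=
  Fintype.linearCombination ℂ fun i : Idx n k => (p i.1 i.2.1 i.2.2.1 i.2.2.2 : ℂ)

theorem evalW_gen {n k : ℕ} (p : Fin k → Fin k → Fin n → Fin n → ℝ)
    (a b : Fin k) (x y : Fin n) : evalW p (gen a b x y) = (p a b x y : ℂ) := by
  simp [evalW, gen, Fintype.linearCombination_apply_single]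

theorem Jrel_le_ker_evalW {n k : ℕ} {p : Fin k → Fin k → Fin n → Fin n → ℝ}
    (hp : IsNSCorrelation n k p) : Jrel n k ≤ LinearMap.ker (evalW p) := by
  obtain ⟨⟨-, hsum⟩, hA, hB⟩ := hp
  refine Submodule.span_le.2 ?_
  rintro _ ((⟨x, y, x', y', rfl⟩ | ⟨a, x, z, w, rfl⟩) | ⟨b, y, z, w, rfl⟩) <;>
    simp only [SetLike.mem_coe, LinearMap.mem_ker, map_sub, map_sum, evalW_gen, sub_eq_zero]
  · exact_mod_cast (hsum x y).trans (hsum x' y').symm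
  · exact_mod_cast hA a x z w
  · exact_mod_cast hB b y z w

theorem sum_Qg_right {n k : ℕ} (a : Fin k) (x z w : Fin n) :
    ∑ c, Qg (k := k) a c x z = ∑ c, Qg a c x w := by
  have h : (∑ c, gen (k := k) a c x z) - ∑ c, gen a c x w ∈ Jrel n k :=
    Submodule.subset_span (.inl (.inr ⟨a, x, z, w, rfl⟩))
  simpa [Qg, ← Submodule.mkQ_apply, map_sum] using (Submodule.Quotient.eq _).2 h

theorem sum_Qg_left {n k : ℕ} (b : Fin k) (y z w : Fin n) :
    ∑ d, Qg (k := k) d b z y = ∑ d, Qg d b w y := by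
  have h : (∑ d, gen (k := k) d b z y) - ∑ d, gen d b w y ∈ Jrel n k :=
    Submodule.subset_span (.inr ⟨b, y, z, w, rfl⟩)
  simpa [Qg, ← Submodule.mkQ_apply, map_sum] using (Submodule.Quotient.eq _).2 h

end NSpace

/-- a correlation is nonsignalling iff it arises from a state on the AOU
space `(V_ns, D_ns, e_ns)`. -/
theorem stmt_16 (n k : ℕ) [NeZero n] [NeZero k]
    (p : Fin k → Fin k → Fin n → Fin n → ℝ) (hp : IsCorrelation n k p) :
    IsNSCorrelation n k p ↔
    ∃ φ : Vns n k →ₗ[ℂ] ℂ, φ (ens n k) = 1 ∧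
      (∀ v ∈ Dns n k, 0 ≤ φ v) ∧
      ∀ a b x y, φ (Qg a b x y) = (p a b x y : ℂ) := by
  constructor
  · intro h
    have hQ : ∀ a b x y, (Jrel n k).liftQ (evalW p) (Jrel_le_ker_evalW h) (Qg a b x y) =
        (p a b x y : ℂ) := fun a b x y => evalW_gen p a b x y
    refine ⟨(Jrel n k).liftQ (evalW p) (Jrel_le_ker_evalW h), ?_, ?_, hQ⟩
    · simp only [ens, map_sum, hQ]
      exact_mod_cast hp.2 0 0
    · rintro _ ⟨t, ht, rfl⟩
      simp only [map_sum, map_smul, hQ, smul_eq_mul]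
      exact Finset.sum_nonneg fun i _ => by exact_mod_cast mul_nonneg (ht i) (hp.1 _ _ _ _)
  · rintro ⟨φ, -, -, hφ⟩
    refine ⟨hp, fun a x w w' => ?_, fun b y z z' => ?_⟩
    · have h := congrArg φ (sum_Qg_right a x w w')
      simp only [map_sum, hφ] at h
      exact_mod_cast h
    · have h := congrArg φ (sum_Qg_left b y z z')
      simp only [map_sum, hφ] at h
      exact_mod_cast h
end
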